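/- Assume (H1). Let h ≥ 0 be an integer, m ∈ {0,...,n}, and a ∈ ℕ^{I_K} with ∑_{i∈I_K} a_i = h. Then P_n(A_{u(m)} = a) = Q_h({a}) · P( |f_{N_1(a)}| = m − h and |f'_{1+N_2(a)}| = n + 1 − m ) / P(|𝐓| = n + 1), where f and f' are two independent Galton–Watson forests with N_1(a) and 1 + N_2(a) roots respectively (a forest with 0 roots having size 0). -/

import Mathlib

open scoped Classical
open Filter
noncomputable section

/-- A planar tree: a finite set of words on `{1,2,...}` containing the root `[]`,
closed under taking fathers and elder brothers. -/
def IsPlanarTree (T : Finset (List ℕ)) : Prop :=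
  [] ∈ T ∧ ∀ (u : List ℕ) (i : ℕ), u ++ [i] ∈ T →
    1 ≤ i ∧ u ∈ T ∧ ∀ j, 1 ≤ j → j ≤ i → u ++ [j] ∈ T

/-- The type of planar trees. -/
def PlanarTree := {T : Finset (List ℕ) // IsPlanarTree T}

/-- Number of children of the vertex `u` in `T`. -/
def numChildren (T : Finset (List ℕ)) (u : List ℕ) : ℕ :=
  (T.filter fun v => ∃ i, v = u ++ [i]).card

/-- Galton-Watson weight of a tree: product over the vertices of `μ (number of children)`. -/
def gwWeight (μ : ℕ → ℝ) (T : Finset (List ℕ)) : ℝ :=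
  ∏ u ∈ T, μ (numChildren T u)

/-- Probability of a set of planar trees under the Galton-Watson measure. -/
def gwProb (μ : ℕ → ℝ) (S : Set PlanarTree) : ℝ :=
  ∑' T : S, gwWeight μ (T : PlanarTree).val

/-- `P(|T| = n)` : probability that the total progeny has `n` vertices. -/
def treeSizeProb (μ : ℕ → ℝ) (n : ℕ) : ℝ :=
  gwProb μ {T | T.val.card = n}

/-- Hypothesis (H1): `μ` is a probability distribution on ℕ, non-degenerate
(`μ 0 + μ 1 ≠ 1`), critical (mean 1), with support bounded by `K > 0`. -/
def H1 (μ : ℕ → ℝ) (K : ℕ) : Prop :=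
  (∀ k, 0 ≤ μ k) ∧ HasSum μ 1 ∧ μ 0 + μ 1 ≠ 1 ∧
    HasSum (fun k : ℕ => (k : ℝ) * μ k) 1 ∧ 0 < K ∧ ∀ k, K < k → μ k = 0

/-- Law of the random walk `W` started at 0 with i.i.d. increments distributed as
`ξ - 1`, `ξ ∼ μ` : `walkProb μ n x = P(W_n = x)`. -/
def walkProb (μ : ℕ → ℝ) : ℕ → ℤ → ℝ
  | 0, x => if x = 0 then 1 else 0
  | n + 1, x => ∑' k : ℕ, μ k * walkProb μ n (x - ((k : ℤ) - 1))

/-- `P_n(S) = P(S | |𝐓| = n+1)` : the Galton-Watson measure conditioned to have `n`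
edges (`n+1` vertices). -/
def condProb (μ : ℕ → ℝ) (n : ℕ) (S : Set PlanarTree) : ℝ :=
  gwProb μ (S ∩ {T | T.val.card = n + 1}) / treeSizeProb μ (n + 1)

/-- `u(k)`, the `(k+1)`-st vertex of `T` in the lexicographical (depth-first) order
(`[]`-junk value if `k` exceeds the number of vertices). -/
def vertexAt (T : PlanarTree) (k : ℕ) : List ℕ :=
  (T.val.sort (· ≤ ·)).getD k []

/-- The index set `I_K = {(k,j) : 1 ≤ j ≤ k ≤ K}` as a finset of `ℕ × ℕ`. -/
def IKfin (K : ℕ) : Finset (ℕ × ℕ) :=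
  (Finset.range (K + 1) ×ˢ Finset.range (K + 1)).filter fun p => 1 ≤ p.2 ∧ p.2 ≤ p.1

/-- The index set `I_K` as a (finite) type. -/
def IK (K : ℕ) := {p : ℕ × ℕ // p ∈ IKfin K}

instance (K : ℕ) : Fintype (IK K) := by unfold IK; infer_instance
instance (K : ℕ) : DecidableEq (IK K) := by unfold IK; infer_instance

/-- The multinomial probability `Q_h({m})` with parameters `h` and `p = (p_{k,j})`,
`p_{k,j} = μ_k`. -/
def Qmult (μ : ℕ → ℝ) (K h : ℕ) (m : IK K → ℕ) : ℝ :=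
  if (∑ i, m i) = h then
    ((h.factorial : ℝ) / ∏ i, ((m i).factorial : ℝ)) * ∏ i : IK K, μ i.val.1 ^ m i
  else 0

/-- `N₁(a) = ∑_{(k,j)} (j-1) a_{k,j}`. -/
def N1 {K : ℕ} (a : IK K → ℕ) : ℕ := ∑ i, (i.val.2 - 1) * a i

/-- `N₂(a) = ∑_{(k,j)} (k-j) a_{k,j}`. -/
def N2 {K : ℕ} (a : IK K → ℕ) : ℕ := ∑ i, (i.val.1 - i.val.2) * a i

/-- Variance of `μ` (whose mean is 1 under (H1)). -/
def gwVar (μ : ℕ → ℝ) : ℝ := ∑' k : ℕ, ((k : ℝ) - 1) ^ 2 * μ k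

/-- The set `J_h` of contents `a ∈ ℕ^{I_K}` with `∑ a = h` whose `N₁` and `N₂` lie in
`[σ²h/2 - h^{2/3}, σ²h/2 + h^{2/3}]`. -/
def Jset (μ : ℕ → ℝ) (K h : ℕ) : Set (IK K → ℕ) :=
  {a | (∑ i, a i) = h ∧
    |(N1 a : ℝ) - gwVar μ * h / 2| ≤ (h : ℝ) ^ ((2 : ℝ) / 3) ∧
    |(N2 a : ℝ) - gwVar μ * h / 2| ≤ (h : ℝ) ^ ((2 : ℝ) / 3)}

/-- `A_{u,k,j}(T)`: the number of strict ancestors `v` of `u` having `k` children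
and such that `u` is a descendant of `v·j`, the `j`-th child of `v`. -/
def Acount (T : PlanarTree) (u : List ℕ) (k j : ℕ) : ℕ :=
  (T.val.filter fun v => (v ++ [j]) <+: u ∧ numChildren T.val v = k).card

/-- `A_{u,l,k,j}(T)`: the number of strict ancestors `v` of `u` at distance at most
`l` from `u`, having `k` children and such that `u` is a descendant of `v·j`. -/
def AcountLe (T : PlanarTree) (u : List ℕ) (l k j : ℕ) : ℕ :=
  (T.val.filter fun v =>
    (v ++ [j]) <+: u ∧ u.length - v.length ≤ l ∧ numChildren T.val v = k).card

/-- `P(|f_k| = n)`: probability that a forest of `k` i.i.d. Galton-Watson trees has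
total size (number of vertices) `n`. -/
def forestSizeProb (μ : ℕ → ℝ) : ℕ → ℕ → ℝ
  | 0, n => if n = 0 then 1 else 0
  | k + 1, n => ∑ m ∈ Finset.range (n + 1), treeSizeProb μ m * forestSizeProb μ k (n - m)

/-- Forest size probability with an integer size (`0` for negative sizes). -/
def forestSizeProbZ (μ : ℕ → ℝ) (k : ℕ) (z : ℤ) : ℝ :=
  if 0 ≤ z then forestSizeProb μ k z.toNat else 0

/-- The vertices of a list of planar trees, the tree at position `p` being put below `i + p`. -/
def forestVertices : ℕ → List PlanarTree → Finset (List ℕ)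
  | _, [] => ∅
  | i, T :: L => T.val.image (List.cons i) ∪ forestVertices (i + 1) L

lemma mem_forestVertices {i : ℕ} {L : List PlanarTree} {v : List ℕ} :
    v ∈ forestVertices i L ↔ ∃ (p : ℕ) (T : PlanarTree) (u : List ℕ),
      L[p]? = some T ∧ u ∈ T.val ∧ v = (i + p) :: u := by
  induction L generalizing i with
  | nil => simp [forestVertices]
  | cons T L ih =>
    simp only [forestVertices, Finset.mem_union, Finset.mem_image, ih]
    constructor
    · rintro (⟨u, hu, rfl⟩ | ⟨p, S, u, hS, hu, rfl⟩)
      · exact ⟨0, T, u, by simp, hu, by simp⟩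
      · exact ⟨p + 1, S, u, by simpa using hS, hu, by simp; omega⟩
    · rintro ⟨p, S, u, hS, hu, rfl⟩
      rcases p with _ | p
      · left
        simp only [List.getElem?_cons_zero, Option.some.injEq] at hS
        subst hS
        exact ⟨u, hu, by simp⟩
      · right
        exact ⟨p, S, u, by simpa using hS, hu, by simp; omega⟩

/-- The vertices of the planar tree whose root has the trees of the list `L` as subtrees. -/
def graftVertices (L : List PlanarTree) : Finset (List ℕ) :=
  insert [] (forestVertices 1 L)

lemma cons_mem_graftVertices {L : List PlanarTree} {c : ℕ} {u : List ℕ} :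
    c :: u ∈ graftVertices L ↔ ∃ (p : ℕ) (T : PlanarTree),
      L[p]? = some T ∧ u ∈ T.val ∧ c = p + 1 := by
  simp only [graftVertices, Finset.mem_insert, reduceCtorEq, false_or, mem_forestVertices,
    List.cons.injEq]
  constructor
  · rintro ⟨p, T, u, h1, h2, h3, rfl⟩
    exact ⟨p, T, h1, h2, by omega⟩
  · rintro ⟨p, T, h1, h2, h3⟩
    exact ⟨p, T, u, h1, h2, by omega, rfl⟩

lemma succ_cons_mem_graftVertices {L : List PlanarTree} {p : ℕ} {T : PlanarTree}
    (hT : L[p]? = some T) {u : List ℕ} : (p + 1) :: u ∈ graftVertices L ↔ u ∈ T.val := by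
  rw [cons_mem_graftVertices]
  constructor
  · rintro ⟨q, S, h1, h2, h3⟩
    obtain rfl : p = q := by omega
    rw [hT] at h1
    cases h1
    exact h2
  · intro h
    exact ⟨p, T, hT, h, rfl⟩

lemma singleton_mem_graftVertices {L : List PlanarTree} {c : ℕ} :
    [c] ∈ graftVertices L ↔ 1 ≤ c ∧ c ≤ L.length := by
  rw [cons_mem_graftVertices]
  constructor
  · rintro ⟨p, T, h1, h2, rfl⟩
    obtain ⟨h, -⟩ := List.getElem?_eq_some_iff.1 h1
    omega
  · rintro ⟨h1, h2⟩
    exact ⟨c - 1, L[c - 1], by simp, L[c - 1].2.1, by omega⟩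

lemma isPlanarTree_graftVertices (L : List PlanarTree) : IsPlanarTree (graftVertices L) := by
  refine ⟨by simp [graftVertices], ?_⟩
  intro u i hu
  rcases u with _ | ⟨c, u⟩
  · rw [List.nil_append, singleton_mem_graftVertices] at hu
    refine ⟨hu.1, by simp [graftVertices], fun j h1 h2 => ?_⟩
    rw [List.nil_append, singleton_mem_graftVertices]
    omega
  · rw [List.cons_append, cons_mem_graftVertices] at hu
    obtain ⟨p, T, hT, hu, rfl⟩ := hu
    simp only [List.cons_append, succ_cons_mem_graftVertices hT]
    exact T.2.2 u i hu

/-- The planar tree whose root has the trees of the list `L` as subtrees. -/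
def graft (L : List PlanarTree) : PlanarTree :=
  ⟨graftVertices L, isPlanarTree_graftVertices L⟩

lemma nil_mem_graft (L : List PlanarTree) : [] ∈ (graft L).val := (graft L).2.1

lemma singleton_mem_of_cons_mem (T : PlanarTree) (c : ℕ) (u : List ℕ) (h : c :: u ∈ T.val) :
    [c] ∈ T.val := by
  induction u using List.reverseRecOn with
  | nil => exact h
  | append_singleton u i ih => exact ih (T.2.2 (c :: u) i h).2.1

lemma graft_injective : Function.Injective graft := by
  intro L M hLM
  have h : graftVertices L = graftVertices M := congrArg Subtype.val hLM
  have hlen : L.length = M.length := by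
    have h1 : ∀ c, (1 ≤ c ∧ c ≤ L.length) ↔ (1 ≤ c ∧ c ≤ M.length) := fun c => by
      rw [← singleton_mem_graftVertices, ← singleton_mem_graftVertices, h]
    have h2 := h1 L.length
    have h3 := h1 M.length
    omega
  refine List.ext_getElem hlen fun p hp hp' => ?_
  apply Subtype.ext
  ext u
  rw [← succ_cons_mem_graftVertices (List.getElem?_eq_getElem hp), h,
    succ_cons_mem_graftVertices (List.getElem?_eq_getElem hp')]

/-- The subtree of descendants of the vertex `[c]`. -/
def subtreeAt (T : PlanarTree) (c : ℕ) (h : [c] ∈ T.val) : PlanarTree :=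
  ⟨T.val.preimage (List.cons c) (fun _ _ _ _ h => (List.cons.inj h).2), by
    refine ⟨Finset.mem_preimage.2 h, fun u i hu => ?_⟩
    have hu' : c :: (u ++ [i]) ∈ T.val := Finset.mem_preimage.1 hu
    have h' := T.2.2 (c :: u) i hu'
    exact ⟨h'.1, Finset.mem_preimage.2 h'.2.1,
      fun j h1 h2 => Finset.mem_preimage.2 (h'.2.2 j h1 h2)⟩⟩

lemma mem_subtreeAt {T : PlanarTree} {c : ℕ} {h : [c] ∈ T.val} {u : List ℕ} :
    u ∈ (subtreeAt T c h).val ↔ c :: u ∈ T.val :=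
  Finset.mem_preimage (hf := fun _ _ _ _ h => (List.cons.inj h).2)

lemma graft_surjective : Function.Surjective graft := by
  intro T
  have hex : ∃ k, [k + 1] ∉ T.val := by
    by_contra! hc
    exact Set.infinite_of_injective_forall_mem (f := fun k : ℕ => [k + 1])
      (fun a b hab => by simpa using hab) hc T.val.finite_toSet
  have hmem : ∀ i, i < Nat.find hex → [i + 1] ∈ T.val := fun i hi => by
    simpa using Nat.find_min hex hi
  have hbd : ∀ c, [c] ∈ T.val → 1 ≤ c ∧ c ≤ Nat.find hex := fun c hc => by
    have h1 := T.2.2 [] c hc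
    refine ⟨h1.1, ?_⟩
    by_contra! hlt
    exact Nat.find_spec hex (h1.2.2 _ (by omega) hlt)
  let f : Fin (Nat.find hex) → PlanarTree := fun i => subtreeAt T (i + 1) (hmem i i.2)
  refine ⟨List.ofFn f, ?_⟩
  apply Subtype.ext
  ext v
  rcases v with _ | ⟨c, u⟩
  · exact iff_of_true (nil_mem_graft _) T.2.1
  · change c :: u ∈ graftVertices _ ↔ _
    rw [cons_mem_graftVertices]
    constructor
    · rintro ⟨p, S, hS, hu, rfl⟩
      obtain ⟨hp, hS⟩ := List.getElem?_eq_some_iff.1 hS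
      rw [List.getElem_ofFn] at hS
      subst hS
      exact mem_subtreeAt.1 hu
    · intro h
      have hc := hbd c (singleton_mem_of_cons_mem T c u h)
      obtain ⟨c, rfl⟩ : ∃ d, c = d + 1 := ⟨c - 1, by omega⟩
      exact ⟨c, f ⟨c, hc.2⟩, List.getElem?_eq_some_iff.2 ⟨by rw [List.length_ofFn]; exact hc.2,
        List.getElem_ofFn _⟩, mem_subtreeAt.2 h, rfl⟩

/-- A planar tree is the same as the list of the subtrees of its root. -/
def graftEquiv : List PlanarTree ≃ PlanarTree :=
  Equiv.ofBijective graft ⟨graft_injective, graft_surjective⟩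

lemma numChildren_graft_nil (L : List PlanarTree) :
    numChildren (graft L).val [] = L.length := by
  have : ((graft L).val.filter fun v => ∃ i, v = [] ++ [i]) =
      (Finset.Icc 1 L.length).image fun i => [i] := by
    ext v
    simp only [Finset.mem_filter, List.nil_append, Finset.mem_image, Finset.mem_Icc]
    constructor
    · rintro ⟨h, i, rfl⟩
      exact ⟨i, singleton_mem_graftVertices.1 h, rfl⟩
    · rintro ⟨i, h, rfl⟩
      exact ⟨singleton_mem_graftVertices.2 h, i, rfl⟩
  rw [numChildren, this, Finset.card_image_of_injective _ fun a b h => by simpa using h]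
  simp

lemma numChildren_graft_cons {L : List PlanarTree} {p : ℕ} {T : PlanarTree}
    (hT : L[p]? = some T) (u : List ℕ) :
    numChildren (graft L).val ((p + 1) :: u) = numChildren T.val u := by
  have : ((graft L).val.filter fun v => ∃ i, v = ((p + 1) :: u) ++ [i]) =
      (T.val.filter fun v => ∃ i, v = u ++ [i]).image (List.cons (p + 1)) := by
    ext v
    simp only [Finset.mem_filter, Finset.mem_image]
    constructor
    · rintro ⟨h, i, rfl⟩
      exact ⟨u ++ [i], ⟨(succ_cons_mem_graftVertices hT).1 h, i, rfl⟩, rfl⟩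
    · rintro ⟨w, ⟨h, i, rfl⟩, rfl⟩
      exact ⟨(succ_cons_mem_graftVertices hT).2 h, i, rfl⟩
  rw [numChildren, this, Finset.card_image_of_injective _ fun a b h => by simpa using h]
  rfl

lemma disjoint_image_cons_forestVertices (i : ℕ) (S : Finset (List ℕ)) (L : List PlanarTree) :
    Disjoint (S.image (List.cons i)) (forestVertices (i + 1) L) := by
  rw [Finset.disjoint_left]
  intro v hv hv'
  obtain ⟨u, -, rfl⟩ := Finset.mem_image.1 hv
  obtain ⟨p, T, w, -, -, h⟩ := mem_forestVertices.1 hv'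
  have := (List.cons.inj h).1
  omega

lemma prod_forestVertices {M : Type*} [CommMonoid M] (g : List ℕ → M)
    (g' : PlanarTree → List ℕ → M) (i : ℕ) (L : List PlanarTree)
    (h : ∀ p T, L[p]? = some T → ∀ u, g ((i + p) :: u) = g' T u) :
    ∏ v ∈ forestVertices i L, g v = (L.map fun T => ∏ u ∈ T.val, g' T u).prod := by
  induction L generalizing i with
  | nil => simp [forestVertices]
  | cons T L ih =>
    rw [forestVertices, Finset.prod_union (disjoint_image_cons_forestVertices i _ L),
      Finset.prod_image fun a _ b _ h => (List.cons.inj h).2, List.map_cons, List.prod_cons,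
      ih (i + 1) fun p S hS u => by
        rw [← h (p + 1) S (by simpa using hS) u]; congr 1; congr 1; omega]
    congr 1
    refine Finset.prod_congr rfl fun u _ => ?_
    simpa using h 0 T (by simp) u

/-- The total number of vertices of a list of planar trees. -/
def forestSize (L : List PlanarTree) : ℕ := (L.map fun T => T.val.card).sum

lemma card_forestVertices (i : ℕ) (L : List PlanarTree) :
    (forestVertices i L).card = forestSize L := by
  induction L generalizing i with
  | nil => simp [forestVertices, forestSize]
  | cons T L ih =>
    rw [forestVertices, Finset.card_union_of_disjoint (disjoint_image_cons_forestVertices i _ L),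
      Finset.card_image_of_injective _ fun a b h => (List.cons.inj h).2, ih]
    simp [forestSize]

lemma nil_notMem_forestVertices (i : ℕ) (L : List PlanarTree) : [] ∉ forestVertices i L := by
  simp [mem_forestVertices]

lemma card_graft (L : List PlanarTree) : (graft L).val.card = forestSize L + 1 := by
  rw [← card_forestVertices 1 L]
  exact Finset.card_insert_of_notMem (nil_notMem_forestVertices 1 L)

/-- The depth-first enumeration of the vertices of a list of planar trees. -/
def forestEnum : ℕ → List PlanarTree → List (List ℕ)
  | _, [] => []
  | i, T :: L => (T.val.sort (· ≤ ·)).map (List.cons i) ++ forestEnum (i + 1) L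

lemma toFinset_forestEnum (i : ℕ) (L : List PlanarTree) :
    (forestEnum i L).toFinset = forestVertices i L := by
  induction L generalizing i with
  | nil => rfl
  | cons T L ih =>
    rw [forestEnum, List.toFinset_append, ih, forestVertices]
    congr 1
    ext v
    simp

lemma cons_lt_cons_of_lt {i j : ℕ} (h : i < j) (u v : List ℕ) : i :: u < j :: v :=
  List.Lex.rel h

lemma cons_strictMono (i : ℕ) : StrictMono (List.cons i) :=
  fun _ _ h => List.Lex.cons h

lemma pairwise_forestEnum (i : ℕ) (L : List PlanarTree) :
    (forestEnum i L).Pairwise (· < ·) := by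
  induction L generalizing i with
  | nil => simp [forestEnum]
  | cons T L ih =>
    rw [forestEnum, List.pairwise_append]
    refine ⟨?_, ih _, fun v hv w hw => ?_⟩
    · rw [List.pairwise_map]
      exact (T.val.sortedLT_sort.pairwise).imp fun h => cons_strictMono i h
    · obtain ⟨u, -, rfl⟩ := List.mem_map.1 hv
      rw [← List.mem_toFinset, toFinset_forestEnum, mem_forestVertices] at hw
      obtain ⟨p, S, z, -, -, rfl⟩ := hw
      exact cons_lt_cons_of_lt (by omega) _ _

lemma sort_graft (L : List PlanarTree) :
    (graft L).val.sort (· ≤ ·) = [] :: forestEnum 1 L := by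
  have hlt : ([] :: forestEnum 1 L).Pairwise (· < ·) := by
    refine List.pairwise_cons.2 ⟨fun v hv => ?_, pairwise_forestEnum 1 L⟩
    rw [← List.mem_toFinset, toFinset_forestEnum, mem_forestVertices] at hv
    obtain ⟨p, S, z, -, -, rfl⟩ := hv
    exact List.Lex.nil
  have h : (graft L).val = ([] :: forestEnum 1 L).toFinset := by
    rw [List.toFinset_cons, toFinset_forestEnum]
    rfl
  rw [h, List.toFinset_sort _ (hlt.imp ne_of_lt)]
  exact hlt.imp le_of_lt

lemma forestEnum_getD (i : ℕ) (L₁ L₂ : List PlanarTree) (T : PlanarTree) (l : ℕ)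
    (hl : l < T.val.card) :
    (forestEnum i (L₁ ++ T :: L₂)).getD (forestSize L₁ + l) [] =
      (i + L₁.length) :: vertexAt T l := by
  induction L₁ generalizing i with
  | nil =>
    have hl' : l < (T.val.sort (· ≤ ·)).length := by simpa using hl
    simp only [List.nil_append, forestEnum, forestSize, List.map_nil, List.sum_nil, zero_add,
      vertexAt, List.length_nil, add_zero]
    rw [List.getD_append _ _ _ _ (by simpa using hl'), List.getD_eq_getElem _ _ (by simpa using hl'),
      List.getD_eq_getElem _ _ hl']
    simp
  | cons S L₁ ih =>
    rw [List.cons_append, forestEnum, List.getD_append_right _ _ _ _ (by simp [forestSize]; omega)]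
    have : forestSize (S :: L₁) + l - (List.map (List.cons i) (S.val.sort (· ≤ ·))).length =
        forestSize L₁ + l := by
      simp [forestSize]
      omega
    rw [this, ih]
    congr 1
    simp
    omega

lemma vertexAt_zero (T : PlanarTree) : vertexAt T 0 = [] := by
  obtain ⟨L, rfl⟩ := graft_surjective T
  rw [vertexAt, sort_graft]
  rfl

lemma vertexAt_graft (L₁ L₂ : List PlanarTree) (T : PlanarTree) (l : ℕ) (hl : l < T.val.card) :
    vertexAt (graft (L₁ ++ T :: L₂)) (forestSize L₁ + l + 1) =
      (L₁.length + 1) :: vertexAt T l := by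
  rw [vertexAt, sort_graft, List.getD_cons_succ, forestEnum_getD _ _ _ _ _ hl, add_comm]

lemma Acount_nil (T : PlanarTree) (k j : ℕ) : Acount T [] k j = 0 := by
  simp [Acount]

lemma Acount_graft {L : List PlanarTree} {p : ℕ} {T : PlanarTree} (hT : L[p]? = some T)
    (u : List ℕ) (k j : ℕ) :
    Acount (graft L) ((p + 1) :: u) k j =
      (if L.length = k ∧ p + 1 = j then 1 else 0) + Acount T u k j := by
  have : ((graft L).val.filter fun v =>
        (v ++ [j]) <+: ((p + 1) :: u) ∧ numChildren (graft L).val v = k) =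
      (if L.length = k ∧ p + 1 = j then {[]} else ∅) ∪
      (T.val.filter fun v => (v ++ [j]) <+: u ∧ numChildren T.val v = k).image
        (List.cons (p + 1)) := by
    ext v
    rcases v with _ | ⟨c, v⟩
    · have h1 := nil_mem_graft L
      have h2 := numChildren_graft_nil L
      split_ifs with h <;> simp [h1, h2] <;> tauto
    · have h0 : c :: v ∉ (if L.length = k ∧ p + 1 = j then {[]} else ∅ : Finset (List ℕ)) := by
        split_ifs <;> simp
      simp only [Finset.mem_union, h0, false_or, Finset.mem_filter, Finset.mem_image,
        List.cons_append, List.cons_prefix_cons, List.cons.injEq]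
      constructor
      · rintro ⟨h1, ⟨rfl, h2⟩, h3⟩
        rw [numChildren_graft_cons hT] at h3
        exact ⟨v, ⟨(succ_cons_mem_graftVertices hT).1 h1, h2, h3⟩, rfl, rfl⟩
      · rintro ⟨w, ⟨h1, h2, h3⟩, rfl, rfl⟩
        refine ⟨(succ_cons_mem_graftVertices hT).2 h1, ⟨rfl, h2⟩, ?_⟩
        rwa [numChildren_graft_cons hT]
  rw [Acount, this, Finset.card_union_of_disjoint, Finset.card_image_of_injective _
    fun a b h => (List.cons.inj h).2]
  · congr 1
    split_ifs <;> rfl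
  · split_ifs <;> simp

/-- The Galton-Watson weight of a planar tree, as an extended nonnegative real. -/
def treeWeight (ν : ℕ → ENNReal) (T : PlanarTree) : ENNReal :=
  ∏ u ∈ T.val, ν (numChildren T.val u)

/-- The Galton-Watson weight of a list of planar trees. -/
def forestWeight (ν : ℕ → ENNReal) (L : List PlanarTree) : ENNReal :=
  (L.map (treeWeight ν)).prod

lemma treeWeight_graft (ν : ℕ → ENNReal) (L : List PlanarTree) :
    treeWeight ν (graft L) = ν L.length * forestWeight ν L := by
  have h : treeWeight ν (graft L) =
      ∏ u ∈ insert [] (forestVertices 1 L), ν (numChildren (graft L).val u) := rfl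
  rw [h, Finset.prod_insert (nil_notMem_forestVertices 1 L), numChildren_graft_nil,
    prod_forestVertices _ (fun T u => ν (numChildren T.val u))]
  · rfl
  · intro p T hT u
    rw [add_comm 1 p, numChildren_graft_cons hT]

/-- The total weight of the trees with `n` vertices. -/
def sizeMass (ν : ℕ → ENNReal) (n : ℕ) : ENNReal :=
  ∑' T : PlanarTree, if T.val.card = n then treeWeight ν T else 0

/-- The generating series of the total progeny. -/
def sizeSeries (ν : ℕ → ENNReal) : PowerSeries ENNReal := PowerSeries.mk (sizeMass ν)

/-- The total weight of the forests with `k` trees and `n` vertices. -/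
def forestMass (ν : ℕ → ENNReal) (k n : ℕ) : ENNReal :=
  ∑' L : List PlanarTree, if L.length = k ∧ forestSize L = n then forestWeight ν L else 0

lemma sum_antidiagonal_ite_mul (n s : ℕ) (c : ENNReal) (g : ℕ → ENNReal) :
    ∑ x ∈ Finset.HasAntidiagonal.antidiagonal n, (if s = x.1 then c else 0) * g x.2 =
      if s ≤ n then c * g (n - s) else 0 := by
  split_ifs with h
  · rw [Finset.sum_eq_single (s, n - s)]
    · simp
    · rintro ⟨x, y⟩ hx hne
      rw [Finset.HasAntidiagonal.mem_antidiagonal] at hx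
      rw [if_neg, zero_mul]
      rintro rfl
      apply hne
      simp only [Prod.mk.injEq, true_and]
      simp only at hx ⊢
      omega
    · intro hx
      exact absurd (Finset.HasAntidiagonal.mem_antidiagonal.2 (by simp only; omega)) hx
  · refine Finset.sum_eq_zero fun x hx => ?_
    rw [Finset.HasAntidiagonal.mem_antidiagonal] at hx
    rw [if_neg (by omega), zero_mul]

lemma tsum_list {α : Type*} (f : List α → ENNReal) :
    ∑' L, f L = f [] + ∑' x, ∑' L, f (x :: L) := by
  let e : Unit ⊕ (α × List α) ≃ List α :=
    { toFun := Sum.elim (fun _ => []) fun p => p.1 :: p.2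
      invFun := fun L => match L with
        | [] => Sum.inl ()
        | x :: L => Sum.inr (x, L)
      left_inv := fun o => by rcases o with _ | ⟨x, L⟩ <;> rfl
      right_inv := fun L => by rcases L with _ | ⟨x, L⟩ <;> rfl }
  rw [← e.tsum_eq, Summable.tsum_sum ENNReal.summable ENNReal.summable, ENNReal.tsum_prod',
    tsum_fintype, Fintype.sum_unique]
  rfl

lemma forestMass_eq_coeff (ν : ℕ → ENNReal) (k n : ℕ) :
    forestMass ν k n = PowerSeries.coeff n (sizeSeries ν ^ k) := by
  induction k generalizing n with
  | zero =>
    rw [forestMass, tsum_list, pow_zero, PowerSeries.coeff_one]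
    simp [forestSize, forestWeight, eq_comm]
  | succ k ih =>
    rw [pow_succ', PowerSeries.coeff_mul, forestMass, tsum_list]
    simp only [← ih]
    simp only [sizeSeries, PowerSeries.coeff_mk, sizeMass, forestMass]
    simp only [← ENNReal.tsum_mul_right]
    simp only [← ENNReal.tsum_mul_left]
    rw [← Summable.tsum_finsetSum fun _ _ => ENNReal.summable]
    simp only [List.length_nil, Nat.zero_ne_add_one, false_and, if_false, zero_add]
    refine tsum_congr fun T => ?_
    rw [← Summable.tsum_finsetSum fun _ _ => ENNReal.summable]
    refine tsum_congr fun L => ?_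
    rw [sum_antidiagonal_ite_mul n T.val.card _
      fun y => if L.length = k ∧ forestSize L = y then forestWeight ν L else 0]
    have hs : forestSize (T :: L) = T.val.card + forestSize L := by simp [forestSize]
    have hw : forestWeight ν (T :: L) = treeWeight ν T * forestWeight ν L := by
      simp [forestWeight]
    rw [hs, hw, List.length_cons, mul_ite, mul_zero, ← ite_and]
    refine if_congr ?_ rfl rfl
    omega

lemma forestSize_append (L₁ L₂ : List PlanarTree) :
    forestSize (L₁ ++ L₂) = forestSize L₁ + forestSize L₂ := by
  simp [forestSize]

lemma forestSize_cons (T : PlanarTree) (L : List PlanarTree) :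
    forestSize (T :: L) = T.val.card + forestSize L := by
  simp [forestSize]

lemma exists_split (L : List PlanarTree) (m : ℕ) (hm : m < forestSize L) :
    ∃ L₁ T L₂, L = L₁ ++ T :: L₂ ∧ forestSize L₁ ≤ m ∧ m < forestSize L₁ + T.val.card := by
  induction L generalizing m with
  | nil => simp [forestSize] at hm
  | cons S L ih =>
    rw [forestSize_cons] at hm
    by_cases h : m < S.val.card
    · exact ⟨[], S, L, rfl, by simp [forestSize], by simpa [forestSize] using h⟩
    · obtain ⟨L₁, T, L₂, rfl, h1, h2⟩ := ih (m - S.val.card) (by omega)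
      refine ⟨S :: L₁, T, L₂, rfl, ?_, ?_⟩ <;> rw [forestSize_cons] <;> omega

lemma split_unique {m : ℕ} {L₁ L₂ M₁ M₂ : List PlanarTree} {T S : PlanarTree}
    (h : L₁ ++ T :: L₂ = M₁ ++ S :: M₂) (h1 : forestSize L₁ ≤ m)
    (h2 : m < forestSize L₁ + T.val.card) (h3 : forestSize M₁ ≤ m)
    (h4 : m < forestSize M₁ + S.val.card) : L₁ = M₁ ∧ T = S ∧ L₂ = M₂ := by
  induction L₁ generalizing m M₁ with
  | nil =>
    rcases M₁ with _ | ⟨R, M₁⟩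
    · simpa using h
    · simp only [List.nil_append, List.cons_append, List.cons.injEq] at h
      obtain ⟨rfl, -⟩ := h
      rw [forestSize_cons] at h3
      simp only [forestSize, List.map_nil, List.sum_nil] at h2
      omega
  | cons R L₁ ih =>
    rcases M₁ with _ | ⟨R', M₁⟩
    · simp only [List.nil_append, List.cons_append, List.cons.injEq] at h
      obtain ⟨rfl, -⟩ := h
      rw [forestSize_cons] at h1
      simp only [forestSize, List.map_nil, List.sum_nil] at h4
      omega
    · simp only [List.cons_append, List.cons.injEq] at h
      obtain ⟨rfl, h⟩ := h
      rw [forestSize_cons] at h1 h2 h3 h4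
      obtain ⟨rfl, rfl, rfl⟩ := ih (m := m - R.val.card) h (by omega) (by omega) (by omega)
        (by omega)
      simp

lemma tsum_list_split (m : ℕ) (g : List PlanarTree → ENNReal)
    (hg : ∀ L, forestSize L ≤ m → g L = 0) :
    ∑' L, g L = ∑' (L₁) (T : PlanarTree) (L₂),
      if forestSize L₁ ≤ m ∧ m < forestSize L₁ + T.val.card then g (L₁ ++ T :: L₂) else 0 := by
  let G : List PlanarTree × PlanarTree × List PlanarTree → ENNReal := fun q =>
    if forestSize q.1 ≤ m ∧ m < forestSize q.1 + q.2.1.val.card then g (q.1 ++ q.2.1 :: q.2.2) else 0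
  have hG : ∑' (L₁) (T : PlanarTree) (L₂),
      (if forestSize L₁ ≤ m ∧ m < forestSize L₁ + T.val.card then g (L₁ ++ T :: L₂) else 0) =
      ∑' q, G q := by
    rw [ENNReal.tsum_prod']
    refine tsum_congr fun L₁ => ?_
    rw [ENNReal.tsum_prod']
  rw [hG]
  refine tsum_eq_tsum_of_ne_zero_bij (fun q => q.1.1 ++ q.1.2.1 :: q.1.2.2) ?_ ?_ ?_
  · rintro ⟨⟨L₁, T, L₂⟩, h⟩ ⟨⟨M₁, S, M₂⟩, h'⟩ heq
    have h := (ite_ne_right_iff.1 h).1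
    have h' := (ite_ne_right_iff.1 h').1
    obtain ⟨rfl, rfl, rfl⟩ := split_unique heq h.1 h.2 h'.1 h'.2
    rfl
  · intro L hL
    obtain ⟨L₁, T, L₂, rfl, h1, h2⟩ := exists_split L m (by
      by_contra! hle
      exact hL (hg L hle))
    exact ⟨⟨(L₁, T, L₂), ite_ne_right_iff.2 ⟨⟨h1, h2⟩, hL⟩⟩, rfl⟩
  · rintro ⟨⟨L₁, T, L₂⟩, h⟩
    exact (if_pos (ite_ne_right_iff.1 h).1).symm

/-- The weight of `T` if it has `m + r` vertices, `r ≠ 0`, and the lineage of its vertex `u(m)`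
is `a`, and zero otherwise. -/
def lineageWeight {K : ℕ} (ν : ℕ → ENNReal) (a : IK K → ℕ) (m r : ℕ) (T : PlanarTree) : ENNReal :=
  if r ≠ 0 ∧ T.val.card = m + r ∧
    ∀ i : IK K, Acount T (vertexAt T m) i.val.1 i.val.2 = a i then treeWeight ν T else 0

/-- The total weight of the trees with `m + r` vertices, `r ≠ 0`, such that the lineage of the
vertex `u(m)` is `a`. -/
def lineageMass {K : ℕ} (ν : ℕ → ENNReal) (a : IK K → ℕ) (m r : ℕ) : ENNReal :=
  ∑' T : PlanarTree, lineageWeight ν a m r T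

lemma lineageMass_zero {K : ℕ} (ν : ℕ → ENNReal) (a : IK K → ℕ) (r : ℕ) :
    lineageMass ν a 0 r = if a = 0 then sizeMass ν r else 0 := by
  simp only [lineageMass, lineageWeight, vertexAt_zero, Acount_nil, zero_add]
  split_ifs with h
  · refine tsum_congr fun T => if_congr ?_ rfl rfl
    subst h
    simp only [Pi.zero_apply, implies_true, and_true, and_iff_right_iff_imp]
    rintro rfl
    exact (Finset.card_pos.2 ⟨[], T.2.1⟩).ne'
  · refine ENNReal.tsum_eq_zero.2 fun T => if_neg ?_
    rintro ⟨-, -, h'⟩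
    exact h (funext fun i => (h' i).symm)

lemma mem_IKfin {K : ℕ} {p : ℕ × ℕ} : p ∈ IKfin K ↔ 1 ≤ p.2 ∧ p.2 ≤ p.1 ∧ p.1 ≤ K := by
  simp only [IKfin, Finset.mem_filter, Finset.mem_product, Finset.mem_range]
  omega

lemma lineage_graft_iff {K : ℕ} (a : IK K → ℕ) (i : IK K) (L₁ L₂ : List PlanarTree)
    (T : PlanarTree) (l : ℕ) (hl : l < T.val.card) (hi : i.val = (L₁.length + 1 + L₂.length,
      L₁.length + 1)) :
    (∀ i' : IK K, Acount (graft (L₁ ++ T :: L₂)) (vertexAt (graft (L₁ ++ T :: L₂))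
      (forestSize L₁ + l + 1)) i'.val.1 i'.val.2 = a i') ↔
    a i ≠ 0 ∧ ∀ i' : IK K, Acount T (vertexAt T l) i'.val.1 i'.val.2 =
      (a - Pi.single i 1 : IK K → ℕ) i' := by
  have hT : (L₁ ++ T :: L₂)[L₁.length]? = some T := by simp
  have key : ∀ i' : IK K, ((L₁ ++ T :: L₂).length = i'.val.1 ∧ L₁.length + 1 = i'.val.2) ↔
      i' = i := by
    intro i'
    rw [show i' = i ↔ i'.val = i.val from Subtype.ext_iff, hi, Prod.ext_iff]
    simp only [List.length_append, List.length_cons]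
    omega
  simp only [vertexAt_graft _ _ _ _ hl, Acount_graft hT, key, Pi.sub_apply, Pi.single_apply]
  constructor
  · intro h
    refine ⟨?_, fun i' => ?_⟩
    · rw [← h i, if_pos rfl]
      omega
    · rw [← h i']
      omega
  · rintro ⟨h0, h⟩ i'
    rw [h i']
    split_ifs with hi'
    · subst hi'
      omega
    · omega

lemma ennreal_tsum_finsetSum {α ι : Type*} (s : Finset ι) (f : ι → α → ENNReal) :
    ∑' x, ∑ i ∈ s, f i x = ∑ i ∈ s, ∑' x, f i x :=
  Summable.tsum_finsetSum fun _ _ => ENNReal.summable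

lemma lineageMass_succ {K : ℕ} (ν : ℕ → ENNReal) (hν : ∀ k, K < k → ν k = 0) (a : IK K → ℕ)
    (m r : ℕ) :
    lineageMass ν a (m + 1) r = ∑ i : IK K, if a i ≠ 0 then ν i.val.1 *
      ∑ x ∈ Finset.HasAntidiagonal.antidiagonal m, ∑ y ∈ Finset.HasAntidiagonal.antidiagonal r,
        forestMass ν (i.val.2 - 1) x.1 * (forestMass ν (i.val.1 - i.val.2) y.1 *
          lineageMass ν (a - Pi.single i 1) x.2 y.2) else 0 := by
  have hR : ∀ i : IK K, (if a i ≠ 0 then ν i.val.1 *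
      ∑ x ∈ Finset.HasAntidiagonal.antidiagonal m, ∑ y ∈ Finset.HasAntidiagonal.antidiagonal r,
        forestMass ν (i.val.2 - 1) x.1 * (forestMass ν (i.val.1 - i.val.2) y.1 *
          lineageMass ν (a - Pi.single i 1) x.2 y.2) else 0) =
      ∑' (L₁ : List PlanarTree) (T : PlanarTree) (L₂ : List PlanarTree),
        if a i ≠ 0 then ν i.val.1 *
          ∑ x ∈ Finset.HasAntidiagonal.antidiagonal m,
            (if L₁.length = i.val.2 - 1 ∧ forestSize L₁ = x.1 then forestWeight ν L₁ else 0) *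
            ∑ y ∈ Finset.HasAntidiagonal.antidiagonal r,
              (if L₂.length = i.val.1 - i.val.2 ∧ forestSize L₂ = y.1
                then forestWeight ν L₂ else 0) *
              lineageWeight ν (a - Pi.single i 1) x.2 y.2 T else 0 := by
    intro i
    by_cases hi : a i = 0
    · simp [hi]
    simp only [if_pos hi, forestMass, lineageMass, ENNReal.tsum_mul_left, ENNReal.tsum_mul_right,
      ennreal_tsum_finsetSum, Finset.mul_sum]
  simp only [hR, ← ennreal_tsum_finsetSum]
  rw [lineageMass, ← graftEquiv.tsum_eq, tsum_list_split m]
  swap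
  · intro L hL
    refine if_neg ?_
    rintro ⟨hr, hc, -⟩
    rw [show graftEquiv L = graft L from rfl, card_graft] at hc
    omega
  refine tsum_congr fun L₁ => tsum_congr fun T => tsum_congr fun L₂ => ?_
  have hgraft : lineageWeight ν a (m + 1) r (graftEquiv (L₁ ++ T :: L₂)) =
      if r ≠ 0 ∧ (graft (L₁ ++ T :: L₂)).val.card = m + 1 + r ∧
        ∀ i : IK K, Acount (graft (L₁ ++ T :: L₂)) (vertexAt (graft (L₁ ++ T :: L₂)) (m + 1))
          i.val.1 i.val.2 = a i then treeWeight ν (graft (L₁ ++ T :: L₂)) else 0 := rfl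
  rw [hgraft, card_graft,
    treeWeight_graft, forestSize_append, forestSize_cons]
  have hlen : (L₁ ++ T :: L₂).length = L₁.length + 1 + L₂.length := by
    simp only [List.length_append, List.length_cons]
    omega
  by_cases hK : L₁.length + 1 + L₂.length ≤ K
  · let i₀ : IK K := ⟨(L₁.length + 1 + L₂.length, L₁.length + 1),
      mem_IKfin.2 ⟨by simp, by simp, hK⟩⟩
    rw [Finset.sum_eq_single i₀]
    · have h1 : L₁.length = i₀.val.2 - 1 := by simp [i₀]
      have h2 : L₂.length = i₀.val.1 - i₀.val.2 := by simp [i₀]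
      have hw : forestWeight ν (L₁ ++ T :: L₂) =
          forestWeight ν L₁ * (forestWeight ν L₂ * treeWeight ν T) := by
        simp only [forestWeight, List.map_append, List.map_cons, List.prod_append, List.prod_cons]
        ring
      simp only [← h1, ← h2, true_and]
      rw [hlen, hw]
      have inner := fun z : ℕ => sum_antidiagonal_ite_mul r (forestSize L₂) (forestWeight ν L₂)
        fun y => lineageWeight ν (a - Pi.single i₀ 1) z y T
      simp only [inner]
      have outer := sum_antidiagonal_ite_mul m (forestSize L₁) (forestWeight ν L₁) fun z =>
        if forestSize L₂ ≤ r then forestWeight ν L₂ *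
          lineageWeight ν (a - Pi.single i₀ 1) z (r - forestSize L₂) T else 0
      simp only [outer]
      simp only [lineageWeight]
      by_cases hs : forestSize L₁ ≤ m
      · obtain ⟨l, rfl⟩ := Nat.exists_eq_add_of_le hs
        rw [Nat.add_sub_cancel_left]
        by_cases hl : l < T.val.card
        · have hD := propext (lineage_graft_iff a i₀ L₁ L₂ T l hl rfl)
          by_cases hC : ∀ i' : IK K, Acount T (vertexAt T l) i'.val.1 i'.val.2 =
            (a - Pi.single i₀ 1 : IK K → ℕ) i'
          · have hC := eq_true hC
            by_cases hi : a i₀ = 0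
            · simp only [hD, hi, ne_eq, not_true, false_and, and_false, if_false, ite_self]
            by_cases hc : forestSize L₂ < r ∧ T.val.card + forestSize L₂ = l + r
            · rw [if_pos (by omega), if_pos (by simp only [hD, hC, and_true]; omega), if_pos hi,
                if_pos hs, if_pos (by omega), if_pos (by simp only [hC, and_true]; omega)]
            · rw [if_pos (by omega), if_neg (by simp only [hD, hC, and_true]; omega), if_pos hi,
                if_pos hs]
              by_cases ht : forestSize L₂ ≤ r
              · rw [if_pos ht, if_neg (by simp only [hC, and_true]; omega)]
                simp
              · simp [ht]
          · have hC := eq_false hC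
            simp only [hD, hC, and_false, if_false, ite_self, mul_zero]
        · have hc : T.val.card ≠ l + (r - forestSize L₂) ∨ r - forestSize L₂ = 0 := by omega
          rw [if_neg (by omega)]
          rcases hc with hc | hc <;>
            simp only [hc, ne_eq, not_true, false_and, and_false, if_false, mul_zero, ite_self]
      · simp [hs]
    · intro i _ hi
      have : ¬ (L₁.length = i.val.2 - 1 ∧ L₂.length = i.val.1 - i.val.2) := by
        rintro ⟨h1, h2⟩
        apply hi
        have h3 := mem_IKfin.1 i.2
        exact Subtype.ext (Prod.ext (by simp only [i₀]; omega) (by simp only [i₀]; omega))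
      by_cases h1 : L₁.length = i.val.2 - 1
      · have h2 : ¬ L₂.length = i.val.1 - i.val.2 := fun h2 => this ⟨h1, h2⟩
        simp [h2]
      · simp [h1]
    · simp
  · rw [hlen, hν _ (by omega)]
    simp only [zero_mul, ite_self]
    refine (Finset.sum_eq_zero fun i _ => ?_).symm
    have : ¬ (L₁.length = i.val.2 - 1 ∧ L₂.length = i.val.1 - i.val.2) := by
      rintro ⟨h1, h2⟩
      have h3 := mem_IKfin.1 i.2
      omega
    by_cases h1 : L₁.length = i.val.2 - 1
    · have h2 : ¬ L₂.length = i.val.1 - i.val.2 := fun h2 => this ⟨h1, h2⟩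
      simp [h2]
    · simp [h1]

/-- The weight of the multinomial distribution with the parameters `p_{k,j} = ν k`. -/
def multinomialWeight {K : ℕ} (ν : ℕ → ENNReal) (a : IK K → ℕ) : ENNReal :=
  (Nat.multinomial Finset.univ a : ENNReal) * ∏ i : IK K, ν i.val.1 ^ a i

lemma mul_multinomial_eq {ι : Type*} [Fintype ι] [DecidableEq ι] (a : ι → ℕ) (i : ι)
    (hi : a i ≠ 0) :
    a i * Nat.multinomial Finset.univ a =
      (∑ j, a j) * Nat.multinomial Finset.univ (a - Pi.single i 1) := by
  have hsum : ∑ j, a j = ∑ j, (a - Pi.single i 1 : ι → ℕ) j + 1 := by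
    have h : ∀ j, a j = (a - Pi.single i 1 : ι → ℕ) j + Pi.single (M := fun _ => ℕ) i 1 j := by
      intro j
      by_cases hj : j = i
      · subst hj
        simp
        omega
      · simp [hj]
    conv_lhs => rw [Finset.sum_congr rfl fun j _ => h j]
    rw [Finset.sum_add_distrib, Finset.sum_pi_single']
    simp
  have hfac : ∏ j, (a j).factorial = a i * ∏ j, ((a - Pi.single i 1 : ι → ℕ) j).factorial := by
    rw [← Finset.mul_prod_erase _ (fun j => (a j).factorial) (Finset.mem_univ i)]
    refine Eq.trans ?_ (congrArg (a i * ·) (Finset.mul_prod_erase _ _ (Finset.mem_univ i)))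
    rw [← mul_assoc]
    congr 1
    · simp [Nat.mul_factorial_pred hi]
    · refine Finset.prod_congr rfl fun j hj => ?_
      simp [Finset.ne_of_mem_erase hj]
  have h1 := Nat.multinomial_spec Finset.univ a
  have h2 := Nat.multinomial_spec Finset.univ (a - Pi.single i 1)
  rw [hsum, Nat.factorial_succ, ← h2, ← hsum, hfac] at h1
  have hpos : 0 < ∏ j, ((a - Pi.single i 1 : ι → ℕ) j).factorial :=
    Finset.prod_pos fun j _ => Nat.factorial_pos _
  refine Nat.eq_of_mul_eq_mul_left hpos ?_
  calc _ = a i * (∏ j, ((a - Pi.single i 1 : ι → ℕ) j).factorial) *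
        Nat.multinomial Finset.univ a := by ring
    _ = _ := by rw [h1]; ring

lemma multinomial_eq_sum {ι : Type*} [Fintype ι] [DecidableEq ι] (a : ι → ℕ) (ha : a ≠ 0) :
    Nat.multinomial Finset.univ a =
      ∑ i, if a i ≠ 0 then Nat.multinomial Finset.univ (a - Pi.single i 1) else 0 := by
  have hpos : 0 < ∑ j, a j := by
    obtain ⟨i, hi⟩ := Function.ne_iff.1 ha
    exact (Nat.pos_of_ne_zero hi).trans_le (Finset.single_le_sum (by simp) (Finset.mem_univ i))
  refine Nat.eq_of_mul_eq_mul_left hpos ?_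
  rw [Finset.mul_sum, Finset.sum_mul]
  refine Finset.sum_congr rfl fun i _ => ?_
  split_ifs with hi
  · exact mul_multinomial_eq a i hi
  · simp [not_not.1 hi]

lemma prod_pow_eq_mul {ι M : Type*} [Fintype ι] [DecidableEq ι] [CommMonoid M] (c : ι → M)
    (a : ι → ℕ) (i : ι) (hi : a i ≠ 0) :
    ∏ j, c j ^ a j = c i * ∏ j, c j ^ (a - Pi.single i 1 : ι → ℕ) j := by
  rw [← Finset.mul_prod_erase _ (fun j => c j ^ a j) (Finset.mem_univ i)]
  refine Eq.trans ?_ (congrArg (c i * ·) (Finset.mul_prod_erase _ _ (Finset.mem_univ i)))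
  rw [← mul_assoc]
  congr 1
  · simp [mul_pow_sub_one hi]
  · refine Finset.prod_congr rfl fun j hj => ?_
    simp [Finset.ne_of_mem_erase hj]

lemma multinomialWeight_eq_sum {K : ℕ} (ν : ℕ → ENNReal) (a : IK K → ℕ) (ha : a ≠ 0) :
    multinomialWeight ν a = ∑ i : IK K,
      if a i ≠ 0 then ν i.val.1 * multinomialWeight ν (a - Pi.single i 1) else 0 := by
  rw [multinomialWeight, multinomial_eq_sum a ha, Nat.cast_sum, Finset.sum_mul]
  refine Finset.sum_congr rfl fun i _ => ?_
  split_ifs with hi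
  · have hprod := prod_pow_eq_mul (fun j : IK K => ν j.val.1) a i hi
    rw [multinomialWeight, hprod, mul_left_comm]
  · simp

lemma sum_mul_eq_add {ι : Type*} [Fintype ι] [DecidableEq ι] (c a : ι → ℕ) (i : ι)
    (hi : a i ≠ 0) :
    ∑ j, c j * a j = c i + ∑ j, c j * (a - Pi.single i 1 : ι → ℕ) j := by
  have h : ∀ j, c j * a j = c j * (a - Pi.single i 1 : ι → ℕ) j +
      Pi.single (M := fun _ => ℕ) i (c i) j := by
    intro j
    by_cases hj : j = i
    · subst hj
      obtain ⟨b, hb⟩ := Nat.exists_eq_succ_of_ne_zero hi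
      simp [hb, Nat.mul_succ]
    · simp [hj]
  rw [Finset.sum_congr rfl fun j _ => h j, Finset.sum_add_distrib, Finset.sum_pi_single']
  simp [add_comm]

lemma sizeMass_zero (ν : ℕ → ENNReal) : sizeMass ν 0 = 0 :=
  ENNReal.tsum_eq_zero.2 fun T => if_neg (Finset.card_pos.2 ⟨[], T.2.1⟩).ne'

lemma lineageMass_eq {K : ℕ} (ν : ℕ → ENNReal) (hν : ∀ k, K < k → ν k = 0) (a : IK K → ℕ)
    (m r : ℕ) :
    lineageMass ν a m r = multinomialWeight ν a *
      (PowerSeries.coeff m (PowerSeries.X ^ (∑ i, a i) * sizeSeries ν ^ N1 a) *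
        PowerSeries.coeff r (sizeSeries ν ^ (1 + N2 a))) := by
  induction m using Nat.strong_induction_on generalizing a r with
  | _ m ih =>
  by_cases ha : a = 0
  · subst ha
    have h : multinomialWeight ν (0 : IK K → ℕ) *
      (PowerSeries.coeff m (PowerSeries.X ^ (∑ i, (0 : IK K → ℕ) i) *
        sizeSeries ν ^ N1 (0 : IK K → ℕ)) *
        PowerSeries.coeff r (sizeSeries ν ^ (1 + N2 (0 : IK K → ℕ)))) =
        if m = 0 then sizeMass ν r else 0 := by
      simp [multinomialWeight, Nat.multinomial, N1, N2, PowerSeries.coeff_one, sizeSeries]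
    rw [h]
    cases m with
    | zero => simp [lineageMass_zero]
    | succ m => simp [lineageMass_succ ν hν]
  have hstep : ∀ i, a i ≠ 0 → ∑ j, a j = 1 + ∑ j, (a - Pi.single i 1 : IK K → ℕ) j := by
    intro i hi
    simpa using sum_mul_eq_add (fun _ => 1) a i hi
  cases m with
  | zero =>
    obtain ⟨i, hi⟩ := Function.ne_iff.1 ha
    rw [lineageMass_zero, if_neg ha, hstep i hi, pow_add, pow_one, mul_assoc,
      PowerSeries.coeff_zero_X_mul, zero_mul, mul_zero]
  | succ m =>
    rw [lineageMass_succ ν hν, multinomialWeight_eq_sum ν a ha, Finset.sum_mul]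
    refine Finset.sum_congr rfl fun i _ => ?_
    split_ifs with hi
    · have h1 : N1 a = (i.val.2 - 1) + N1 (a - Pi.single i 1) :=
        sum_mul_eq_add (fun i : IK K => i.val.2 - 1) a i hi
      have h2 : N2 a = (i.val.1 - i.val.2) + N2 (a - Pi.single i 1) := 
        sum_mul_eq_add (fun i : IK K => i.val.1 - i.val.2) a i hi
      have h3 : PowerSeries.X ^ (∑ j, a j) * sizeSeries ν ^ N1 a = PowerSeries.X *
          (sizeSeries ν ^ (i.val.2 - 1) * (PowerSeries.X ^ (∑ j, (a - Pi.single i 1 : IK K → ℕ) j) *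
            sizeSeries ν ^ N1 (a - Pi.single i 1))) := by
        rw [hstep i hi, h1]
        ring
      have h4 : sizeSeries ν ^ (1 + N2 a) = sizeSeries ν ^ (i.val.1 - i.val.2) *
          sizeSeries ν ^ (1 + N2 (a - Pi.single i 1)) := by
        rw [h2]
        ring
      rw [h3, h4, PowerSeries.coeff_succ_X_mul, PowerSeries.coeff_mul,
        PowerSeries.coeff_mul _ (_ ^ _), Finset.sum_mul_sum, mul_assoc]
      congr 1
      rw [Finset.mul_sum]
      refine Finset.sum_congr rfl fun x hx => ?_
      rw [Finset.mul_sum]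
      refine Finset.sum_congr rfl fun y _ => ?_
      rw [Finset.HasAntidiagonal.mem_antidiagonal] at hx
      rw [ih x.2 (by omega), forestMass_eq_coeff, forestMass_eq_coeff]
      ring
    · rw [zero_mul]

lemma sizeMass_succ {K : ℕ} (ν : ℕ → ENNReal) (hν : ∀ k, K < k → ν k = 0) (n : ℕ) :
    sizeMass ν (n + 1) = ∑ k ∈ Finset.range (K + 1), ν k * forestMass ν k n := by
  simp only [sizeMass, forestMass, ← ENNReal.tsum_mul_left, ← ennreal_tsum_finsetSum]
  rw [← graftEquiv.tsum_eq]
  refine tsum_congr fun L => ?_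
  have h : (graftEquiv L).val.card = forestSize L + 1 := card_graft L
  have h' : treeWeight ν (graftEquiv L) = ν L.length * forestWeight ν L := treeWeight_graft ν L
  simp only [h, h', Nat.add_right_cancel_iff]
  by_cases hL : L.length ≤ K
  · rw [Finset.sum_eq_single L.length]
    · simp
    · intro k _ hk
      simp [hk.symm]
    · intro hK
      exact absurd (Finset.mem_range.2 (by omega)) hK
  · rw [hν _ (by omega), zero_mul, ite_self, Finset.sum_eq_zero]
    intro k hk
    rw [Finset.mem_range] at hk
    rw [if_neg (by omega), mul_zero]

lemma coeff_pow_ne_top {P : PowerSeries ENNReal} {n : ℕ}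
    (hP : ∀ i ≤ n, PowerSeries.coeff i P ≠ ⊤) (k : ℕ) : PowerSeries.coeff n (P ^ k) ≠ ⊤ := by
  induction k generalizing n with
  | zero =>
    rw [pow_zero, PowerSeries.coeff_one]
    split_ifs <;> simp
  | succ k ih =>
    rw [pow_succ', PowerSeries.coeff_mul]
    refine ENNReal.sum_ne_top.2 fun x hx => ?_
    rw [Finset.HasAntidiagonal.mem_antidiagonal] at hx
    exact ENNReal.mul_ne_top (hP _ (by omega)) (ih fun i hi => hP i (by omega))

lemma sizeMass_ne_top {K : ℕ} {ν : ℕ → ENNReal} (hν : ∀ k, K < k → ν k = 0)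
    (hfin : ∀ k, ν k ≠ ⊤) (n : ℕ) : sizeMass ν n ≠ ⊤ := by
  induction n using Nat.strong_induction_on with
  | _ n ih =>
  cases n with
  | zero => simp [sizeMass_zero]
  | succ n =>
    rw [sizeMass_succ ν hν]
    refine ENNReal.sum_ne_top.2 fun k _ => ENNReal.mul_ne_top (hfin k) ?_
    rw [forestMass_eq_coeff]
    refine coeff_pow_ne_top (fun i hi => ?_) k
    rw [sizeSeries, PowerSeries.coeff_mk]
    exact ih i (by omega)

lemma toReal_treeWeight {μ : ℕ → ℝ} (hμ : ∀ k, 0 ≤ μ k) (T : PlanarTree) :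
    (treeWeight (fun k => ENNReal.ofReal (μ k)) T).toReal = gwWeight μ T.val := by
  rw [treeWeight, gwWeight, ENNReal.toReal_prod]
  exact Finset.prod_congr rfl fun u _ => ENNReal.toReal_ofReal (hμ _)

lemma treeWeight_ne_top {ν : ℕ → ENNReal} (hfin : ∀ k, ν k ≠ ⊤) (T : PlanarTree) :
    treeWeight ν T ≠ ⊤ :=
  ENNReal.prod_ne_top fun _ _ => hfin _

lemma gwProb_eq_toReal {μ : ℕ → ℝ} (hμ : ∀ k, 0 ≤ μ k) (S : Set PlanarTree) :
    gwProb μ S = (∑' T : PlanarTree,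
      if T ∈ S then treeWeight (fun k => ENNReal.ofReal (μ k)) T else 0).toReal := by
  have h : (∑' T : PlanarTree, if T ∈ S then treeWeight (fun k => ENNReal.ofReal (μ k)) T else 0) =
      ∑' T : S, treeWeight (fun k => ENNReal.ofReal (μ k)) T := by
    rw [tsum_subtype]
    rfl
  rw [h, ENNReal.tsum_toReal_eq fun T : S => treeWeight_ne_top (fun _ => ENNReal.ofReal_ne_top) T.1]
  exact tsum_congr fun T => (toReal_treeWeight hμ T.1).symm

lemma treeSizeProb_eq_toReal {μ : ℕ → ℝ} (hμ : ∀ k, 0 ≤ μ k) (n : ℕ) :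
    treeSizeProb μ n = (sizeMass (fun k => ENNReal.ofReal (μ k)) n).toReal := by
  rw [treeSizeProb, gwProb_eq_toReal hμ, sizeMass]
  congr 1
  exact tsum_congr fun T => by congr

lemma forestSizeProb_eq_toReal {μ : ℕ → ℝ} {K : ℕ} (hμ : ∀ k, 0 ≤ μ k) (hK : ∀ k, K < k → μ k = 0)
    (k n : ℕ) : forestSizeProb μ k n =
      (PowerSeries.coeff n (sizeSeries (fun k => ENNReal.ofReal (μ k)) ^ k)).toReal := by
  have hne := sizeMass_ne_top (K := K) (ν := fun k => ENNReal.ofReal (μ k))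
    (fun k hk => by simp [hK k hk]) fun _ => ENNReal.ofReal_ne_top
  have hP : ∀ i, PowerSeries.coeff i (sizeSeries (fun k => ENNReal.ofReal (μ k))) ≠ ⊤ := by
    intro i
    rw [sizeSeries, PowerSeries.coeff_mk]
    exact hne i
  induction k generalizing n with
  | zero =>
    rw [forestSizeProb, pow_zero, PowerSeries.coeff_one]
    split_ifs <;> simp
  | succ k ih =>
    rw [forestSizeProb, pow_succ', PowerSeries.coeff_mul, ENNReal.toReal_sum,
      Finset.Nat.sum_antidiagonal_eq_sum_range_succ_mk]
    · refine Finset.sum_congr rfl fun i _ => ?_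
      rw [ih, treeSizeProb_eq_toReal hμ, ENNReal.toReal_mul, sizeSeries, PowerSeries.coeff_mk]
    · intro x _
      exact ENNReal.mul_ne_top (hP _) (coeff_pow_ne_top (fun i _ => hP i) k)

lemma forestSizeProbZ_sub_eq_toReal {μ : ℕ → ℝ} {K : ℕ} (hμ : ∀ k, 0 ≤ μ k)
    (hK : ∀ k, K < k → μ k = 0) (k m h : ℕ) : forestSizeProbZ μ k ((m : ℤ) - h) =
      (PowerSeries.coeff m (PowerSeries.X ^ h *
        sizeSeries (fun k => ENNReal.ofReal (μ k)) ^ k)).toReal := by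
  rw [forestSizeProbZ, PowerSeries.coeff_X_pow_mul']
  by_cases hm : h ≤ m
  · rw [if_pos (by omega), if_pos hm, ← forestSizeProb_eq_toReal hμ hK]
    congr 1
    omega
  · rw [if_neg (by omega), if_neg hm, ENNReal.toReal_zero]

lemma Qmult_eq_toReal {μ : ℕ → ℝ} {K : ℕ} (hμ : ∀ k, 0 ≤ μ k) (a : IK K → ℕ) :
    Qmult μ K (∑ i, a i) a = (multinomialWeight (fun k => ENNReal.ofReal (μ k)) a).toReal := by
  rw [Qmult, if_pos rfl, multinomialWeight, ENNReal.toReal_mul, ENNReal.toReal_natCast,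
    ENNReal.toReal_prod]
  congr 1
  · rw [div_eq_iff (Finset.prod_ne_zero_iff.2 fun i _ => by positivity), mul_comm,
      ← Nat.multinomial_spec Finset.univ a]
    push_cast
    rfl
  · refine Finset.prod_congr rfl fun i _ => ?_
    rw [ENNReal.toReal_pow, ENNReal.toReal_ofReal (hμ _)]

/-- Assume (H1).  Let `h ≥ 0`, `m ∈ {0,…,n}` and `a ∈ ℕ^{I_K}` with `∑ a = h`.  Then
`P_n(A_{u(m)} = a) = Q_h({a}) · P(|f_{N₁(a)}| = m-h, |f'_{1+N₂(a)}| = n+1-m) / P(|𝐓| = n+1)`,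
where `f` and `f'` are independent Galton-Watson forests (so the probability
factorizes as a product of the two forest-size probabilities). -/
theorem statement12
    (μ : ℕ → ℝ) (K : ℕ) (hμ : H1 μ K) (n m h : ℕ) (hm : m ≤ n)
    (a : IK K → ℕ) (ha : (∑ i, a i) = h) :
    condProb μ n
        {T | ∀ i : IK K, Acount T (vertexAt T m) i.val.1 i.val.2 = a i} =
      Qmult μ K h a *
        (forestSizeProbZ μ (N1 a) ((m : ℤ) - (h : ℤ)) *
          forestSizeProbZ μ (1 + N2 a) ((n : ℤ) + 1 - (m : ℤ))) /
        treeSizeProb μ (n + 1) := by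
  obtain ⟨h0, -, -, -, -, hK⟩ := hμ
  subst ha
  set ν : ℕ → ENNReal := fun k => ENNReal.ofReal (μ k)
  have hν : ∀ k, K < k → ν k = 0 := fun k hk => by simp [ν, hK k hk]
  have hS : gwProb μ ({T | ∀ i : IK K, Acount T (vertexAt T m) i.val.1 i.val.2 = a i} ∩
      {T | T.val.card = n + 1}) = (lineageMass ν a m (n + 1 - m)).toReal := by
    rw [gwProb_eq_toReal h0, lineageMass]
    congr 1
    refine tsum_congr fun T => ?_
    rw [lineageWeight]
    congr 1
    rw [Set.mem_inter_iff, and_comm, ← and_assoc]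
    refine propext (and_congr ?_ Iff.rfl)
    rw [Set.mem_ofPred_eq]
    omega
  rw [condProb, hS, lineageMass_eq ν hν, ENNReal.toReal_mul, ENNReal.toReal_mul,
    Qmult_eq_toReal h0, forestSizeProbZ_sub_eq_toReal h0 hK,
    show (n : ℤ) + 1 - m = ((n + 1 - m : ℕ) : ℤ) - (0 : ℕ) by omega,
    forestSizeProbZ_sub_eq_toReal h0 hK, pow_zero, one_mul]

end
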